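/- arXiv:0708.1352 — 2 statements merged into one kernel-verified Lean document; each statement's English description precedes it below -/
import Mathlib

section
/- Let F be a field of characteristic zero, D a derivation on F with constant subfield C. If x_1,…,x_n, y_1,…,y_n ∈ F (with each y_i ≠ 0) satisfy D x_i = (D y_i)/y_i for each i, and x_1,…,x_n are Q-linearly independent modulo C, then the transcendence degree of C(x_1,y_1,…,x_n,y_n) over C is at least n+1. -/
set_option synthInstance.maxHeartbeats 1000000
set_option maxHeartbeats 1000000

/-- Transcendence degree of a field extension, as the supremum of cardinalities of
algebraically independent subsets. -/
noncomputable def trdeg (K L : Type*) [Field K] [Field L] [Algebra K L] : Cardinal :=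
  ⨆ s : {s : Set L // AlgebraicIndependent K ((↑) : s → L)}, Cardinal.mk s.1

section AxProof

open Polynomial IntermediateField TensorProduct
open scoped IntermediateField.algebraAdjoinAdjoin

namespace AxS

lemma exists_ext (R S T : Type*) [CommRing R] [CommRing S] [CommRing T]
    [Algebra R S] [Algebra R T] [Algebra S T] [IsScalarTower R S T]
    [Algebra.FormallyEtale S T] (d : Derivation R S T) :
    ∃ d' : Derivation R T T, ∀ s, d' (algebraMap S T s) = d s := by
  refine ⟨((d.liftKaehlerDifferential.liftBaseChange T).comp
    (KaehlerDifferential.tensorKaehlerEquivOfFormallyEtale R S T).symm.toLinearMap).compDer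
    (KaehlerDifferential.D R T), fun s => ?_⟩
  have := KaehlerDifferential.tensorKaehlerEquivOfFormallyEtale_symm_D_algebraMap R S T s
  simp [this]

/-- kernel of a derivation as an intermediate field -/
def kerField {k F M : Type*} [Field k] [Field F] [Algebra k F] [AddCommGroup M] [Module F M]
    [Module k M] (d : Derivation k F M) :
    IntermediateField k F where
  carrier := {a | d a = 0}
  mul_mem' := by intro a b ha hb; simp_all
  add_mem' := by intro a b ha hb; simp_all
  algebraMap_mem' := by intro a; simp
  inv_mem' := by
    intro a ha
    by_cases h : a = 0
    · simp [h]
    · simp_all [Derivation.leibniz_inv]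

/-- a derivation is linear over its kernel -/
def kerDer {k F M : Type*} [Field k] [Field F] [Algebra k F] [AddCommGroup M] [Module F M]
    [Module k M] (d : Derivation k F M) :
    Derivation (kerField d) F M where
  toFun := d
  map_add' := map_add d
  map_smul' := by
    intro a b
    have : d (a : F) = 0 := a.2
    have h2 : a • b = (a : F) * b := rfl
    rw [h2, Derivation.leibniz, this]
    simp
    rfl
  map_one_eq_zero' := by simp
  leibniz' := by intro a b; simp

lemma der_zero_of_alg {E F M : Type*} [Field E] [Field F] [CharZero E] [Algebra E F]
    [AddCommGroup M] [Module F M] [Module E M] [IsScalarTower E F M]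
    (d : Derivation E F M) (a : F) (ha : IsAlgebraic E a) : d a = 0 := by
  have h := d.map_aeval (minpoly E a) a
  rw [minpoly.aeval, map_zero] at h
  have hs : (minpoly E a).Separable := (minpoly.irreducible ha.isIntegral).separable
  have := hs.aeval_derivative_ne_zero (minpoly.aeval E a)
  exact (smul_eq_zero.mp h.symm).resolve_left this

lemma der_zero_of_adjoin {k F M : Type*} [Field k] [Field F] [CharZero k] [Algebra k F]
    [AddCommGroup M] [Module F M] [Module k M]
    (d : Derivation k F M) (S : Set F) (hS : ∀ a ∈ S, d a = 0)
    (a : F) (ha : IsAlgebraic (Algebra.adjoin k S) a) : d a = 0 := by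
  have h : Algebra.adjoin k S ≤ (kerField d).toSubalgebra := Algebra.adjoin_le hS
  let := (Subalgebra.inclusion h).toRingHom.toAlgebra
  have : IsScalarTower (Algebra.adjoin k S) (kerField d).toSubalgebra F :=
    IsScalarTower.of_algebraMap_eq (fun x => rfl)
  have hinj : Function.Injective (algebraMap (Algebra.adjoin k S) (kerField d).toSubalgebra) :=
    Subalgebra.inclusion_injective h
  have h2 : IsAlgebraic (kerField d).toSubalgebra a := ha.extendScalars hinj
  have h3 : IsAlgebraic (kerField d) a := h2
  have : CharZero (kerField d) := charZero_of_injective_algebraMap (algebraMap k _).injective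
  exact der_zero_of_alg (kerDer d) a h3

lemma exists_der {k F : Type*} [Field k] [Field F] [CharZero k] [Algebra k F] (t : F)
    (ht : Transcendental k t) [Algebra.IsAlgebraic k⟮t⟯ F] :
    ∃ δ : Derivation k F F, δ t = 1 := by
  have : Algebra.FormallyEtale k⟮t⟯ F := Algebra.FormallyEtale.of_isSeparable _ _
  have : Algebra.FormallyEtale (Algebra.adjoin k {t}) k⟮t⟯ :=
    Algebra.FormallyEtale.of_isLocalization (nonZeroDivisors (Algebra.adjoin k {t}))
  have : Algebra.FormallyEtale (Algebra.adjoin k {t}) F :=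
    Algebra.FormallyEtale.comp _ k⟮t⟯ _
  let e := Polynomial.algEquivOfTranscendental k t ht
  have he : ∀ a, aeval t (e.symm a) = (a : F) := by
    intro a
    obtain ⟨p, rfl⟩ := e.surjective a
    simp [e]
  let d : Derivation k (Algebra.adjoin k {t}) F := Derivation.mk'
    ((aeval t).toLinearMap ∘ₗ Polynomial.derivative ∘ₗ e.symm.toLinearMap) (by
      intro a b
      simp [he, Algebra.smul_def]
      ring)
  obtain ⟨δ, hδ⟩ := exists_ext k (Algebra.adjoin k {t}) F d
  refine ⟨δ, ?_⟩
  have := hδ (e X)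
  simpa [d, e] using this

lemma der_mem {k F : Type*} [Field k] [Field F] [Algebra k F] (t : F)
    (δ : Derivation k F F) (hδ : δ t = 1) (a : F) (ha : a ∈ k⟮t⟯) : δ a ∈ k⟮t⟯ := by
  induction ha using IntermediateField.adjoin_induction with
  | mem x hx => simp at hx; subst hx; rw [hδ]; exact one_mem _
  | algebraMap x => simp
  | add x y hx hy h1 h2 => rw [map_add]; exact add_mem h1 h2
  | inv x hx h1 =>
    rw [Derivation.leibniz_inv]
    exact mul_mem (neg_mem (pow_mem (inv_mem hx) _)) h1
  | mul x y hx hy h1 h2 =>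
    rw [Derivation.leibniz]
    exact add_mem (mul_mem hx h2) (mul_mem hy h1)

/-- Functions of `t` regular at `0`. -/
def regRing {k F : Type*} [Field k] [Field F] [Algebra k F] (t : F) : Subring F where
  carrier := {a | ∃ p q : k[X], q.coeff 0 ≠ 0 ∧ a * aeval t q = aeval t p}
  mul_mem' := by
    rintro a b ⟨p, q, hq, h⟩ ⟨p', q', hq', h'⟩
    refine ⟨p * p', q * q', by simp [mul_coeff_zero, hq, hq'], ?_⟩
    rw [map_mul, map_mul, ← h, ← h']; ring
  add_mem' := by
    rintro a b ⟨p, q, hq, h⟩ ⟨p', q', hq', h'⟩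
    refine ⟨p * q' + p' * q, q * q', by simp [mul_coeff_zero, hq, hq'], ?_⟩
    rw [map_mul, map_add, map_mul, map_mul, ← h, ← h']; ring
  one_mem' := ⟨1, 1, by simp, by simp⟩
  zero_mem' := ⟨0, 1, by simp, by simp⟩
  neg_mem' := by
    rintro a ⟨p, q, hq, h⟩
    exact ⟨-p, q, hq, by rw [map_neg, ← h]; ring⟩

section reg
variable {k F : Type*} [Field k] [Field F] [Algebra k F] {t : F}

lemma aeval_ne (ht : Transcendental k t) {q : k[X]} (hq : q ≠ 0) : aeval t q ≠ 0 := by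
  intro h
  exact hq (transcendental_iff.mp ht q h)

lemma ne_of_coeff {q : k[X]} (hq : q.coeff 0 ≠ 0) : q ≠ 0 := by
  rintro rfl; simp at hq

lemma aeval_mem (p : k[X]) : aeval t p ∈ regRing (k := k) t := ⟨p, 1, by simp, by simp⟩

lemma aeval_inv_mem (ht : Transcendental k t) (p : k[X]) (hp : p.coeff 0 ≠ 0) :
    (aeval t p)⁻¹ ∈ regRing (k := k) t :=
  ⟨1, p, hp, by simp [inv_mul_cancel₀ (aeval_ne ht (ne_of_coeff hp))]⟩

lemma algebraMap_mem_reg (c : k) : algebraMap k F c ∈ regRing (k := k) t := by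
  simpa using aeval_mem (t := t) (C c)

lemma t_mem : t ∈ regRing (k := k) t := by simpa using aeval_mem (t := t) (X : k[X])

lemma t_inv_not_mem (ht : Transcendental k t) : t⁻¹ ∉ regRing (k := k) t := by
  rintro ⟨p, q, hq, h⟩
  have ht0 : t ≠ 0 := by rintro rfl; exact ht (isAlgebraic_zero)
  have : aeval t (q - X * p) = 0 := by
    rw [map_sub, map_mul, ← h]; simp; field_simp; simp
  have := transcendental_iff.mp ht _ this
  rw [sub_eq_zero] at this
  apply hq; rw [this]; simp

lemma der_reg (ht : Transcendental k t) (δ : Derivation k F F) (hδ : δ t = 1) {a : F}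
    (ha : a ∈ regRing (k := k) t) : δ a ∈ regRing (k := k) t := by
  have hd : ∀ p : k[X], δ (aeval t p) = aeval t (derivative p) := by
    intro p; rw [Derivation.map_aeval, hδ]; simp
  obtain ⟨p, q, hq, h⟩ := ha
  have hq0 := aeval_ne ht (ne_of_coeff hq)
  have h1 := congrArg δ h
  rw [Derivation.leibniz, hd, hd] at h1
  refine ⟨derivative p * q - p * derivative q, q * q, by simp [mul_coeff_zero, hq], ?_⟩
  simp only [map_sub, map_mul, ← h, ← h1, smul_eq_mul]
  ring

lemma exists_decomp (ht : Transcendental k t) (g : F) (hg : g ∈ k⟮t⟯) (hg0 : g ≠ 0) :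
    ∃ (m : ℤ) (u : F), u ∈ regRing (k := k) t ∧ u⁻¹ ∈ regRing (k := k) t ∧ g = t ^ m * u := by
  have ht0 : t ≠ 0 := by rintro rfl; exact ht (isAlgebraic_zero)
  have hp : ∀ p : k[X], p ≠ 0 → ∃ (m : ℕ) (u : F), u ∈ regRing (k := k) t ∧
      u⁻¹ ∈ regRing (k := k) t ∧ aeval t p = t ^ m * u := by
    intro p hp
    obtain ⟨q, hq, hx⟩ := Polynomial.exists_eq_pow_rootMultiplicity_mul_and_not_dvd p hp 0
    have hq0 : q.coeff 0 ≠ 0 := by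
      intro h; apply hx; simpa [X_dvd_iff] using h
    refine ⟨rootMultiplicity 0 p, aeval t q, aeval_mem _, aeval_inv_mem ht _ hq0, ?_⟩
    conv_lhs => rw [hq]
    simp
  obtain ⟨r, s, rfl⟩ := (IntermediateField.mem_adjoin_simple_iff k g).mp hg
  have hr : r ≠ 0 := by rintro rfl; simp at hg0
  have hs : s ≠ 0 := by rintro rfl; simp at hg0
  obtain ⟨m, u, h1, h2, h3⟩ := hp r hr
  obtain ⟨m', u', h1', h2', h3'⟩ := hp s hs
  refine ⟨m - m', u * u'⁻¹, mul_mem h1 h2', ?_, ?_⟩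
  · rw [mul_inv, inv_inv]; exact mul_mem h2 h1'
  · rw [h3, h3', zpow_sub₀ ht0]; simp; field_simp

lemma residue [CharZero k] (ht : Transcendental k t) (δ : Derivation k F F) (hδ : δ t = 1)
    {ι : Type*} [Fintype ι] (e : ι → k) (m : ι → ℤ) (u : ι → F)
    (hu0 : ∀ i, u i ≠ 0)
    (hu : ∀ i, u i ∈ regRing (k := k) t) (hu' : ∀ i, (u i)⁻¹ ∈ regRing (k := k) t)
    (h : F) (hh : h ∈ k⟮t⟯)
    (H : ∑ i, algebraMap k F (e i) * (δ (t ^ m i * u i) / (t ^ m i * u i)) = δ h) :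
    ∑ i, (m i : k) * e i = 0 := by
  have ht0 : t ≠ 0 := by rintro rfl; exact ht (isAlgebraic_zero)
  have hpow : ∀ (n : ℤ), δ (t ^ n) = n * t ^ (n - 1) := by
    intro n; rw [Derivation.leibniz_zpow, hδ]; simp
  set R := regRing (k := k) t with hR
  set s : k := ∑ i, (m i : k) * e i with hs
  have h1 : ∃ r ∈ R, δ h = algebraMap k F s * t⁻¹ + r := by
    refine ⟨∑ i, algebraMap k F (e i) * (δ (u i) * (u i)⁻¹), ?_, ?_⟩
    · exact sum_mem fun i _ => mul_mem (algebraMap_mem_reg _)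
        (mul_mem (der_reg ht δ hδ (hu i)) (hu' i))
    · rw [← H, hs, map_sum, Finset.sum_mul, ← Finset.sum_add_distrib]
      refine Finset.sum_congr rfl fun i _ => ?_
      rw [Derivation.leibniz, hpow, zpow_sub₀ ht0]
      have := hu0 i
      have h3 : t ^ m i ≠ 0 := zpow_ne_zero _ ht0
      simp only [smul_eq_mul, map_mul, map_intCast]
      field_simp
      ring
  obtain ⟨r, hr, h1⟩ := h1
  have tp : ∀ n : ℤ, 0 ≤ n → t ^ n ∈ R := by
    intro n hn; lift n to ℕ using hn; rw [zpow_natCast]; exact pow_mem t_mem _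
  have key : δ h ∈ R := by
    by_cases hh0 : h = 0
    · rw [hh0, map_zero]; exact zero_mem _
    obtain ⟨l, v, hv, hv', rfl⟩ := exists_decomp ht h hh hh0
    have hv0 : v ≠ 0 := by rintro rfl; simp at hh0
    rcases lt_or_ge l 0 with hl | hl
    · exfalso
      rw [Derivation.leibniz, hpow] at h1
      have h2 : (l : F) * v = t * (algebraMap k F s * t ^ (-l-1) + r * t^(-l) - δ v) := by
        simp only [smul_eq_mul] at h1
        have e1 : t ^ (l-1) = t ^ l * t⁻¹ := zpow_sub_one₀ ht0 l
        have e2 : t ^ (-l-1) = (t ^ l)⁻¹ * t⁻¹ := by rw [zpow_sub_one₀ ht0, zpow_neg]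
        have e3 : t ^ (-l) = (t^l)⁻¹ := zpow_neg _ _
        rw [e1] at h1
        rw [e2, e3]
        have h3 : t ^ l ≠ 0 := zpow_ne_zero _ ht0
        field_simp
        field_simp at h1
        linear_combination h1
      have hl0 : (l : k) ≠ 0 := by exact_mod_cast hl.ne
      have hlF : (l : F) ≠ 0 := by
        rw [← map_intCast (algebraMap k F)]; exact (_root_.map_ne_zero _).mpr hl0
      have h4 : t⁻¹ = algebraMap k F ((l : k)⁻¹) * v⁻¹ *
          (algebraMap k F s * t ^ (-l-1) + r * t^(-l) - δ v) := by
        rw [map_inv₀, map_intCast]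
        field_simp
        linear_combination h2
      apply t_inv_not_mem ht
      rw [h4]
      exact mul_mem (mul_mem (algebraMap_mem_reg _) hv') (sub_mem (add_mem
        (mul_mem (algebraMap_mem_reg _) (tp _ (by omega))) (mul_mem hr (tp _ (by omega))))
        (der_reg ht δ hδ hv))
    · rw [Derivation.leibniz, hpow]
      refine add_mem (mul_mem (tp _ hl) (der_reg ht δ hδ hv)) (mul_mem hv ?_)
      rcases hl.eq_or_lt with h0 | h0
      · rw [← h0]; simp
      · refine mul_mem ?_ (tp _ (by omega))
        exact intCast_mem R l
  by_contra hs0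
  apply t_inv_not_mem ht
  have : t⁻¹ = algebraMap k F s⁻¹ * (δ h - r) := by
    rw [h1, map_inv₀]
    have : algebraMap k F s ≠ 0 := by simpa using hs0
    field_simp
    ring
  rw [this]
  exact mul_mem (algebraMap_mem_reg _) (sub_mem key hr)

end reg

lemma der_zero_tower {k E L : Type*} [Field k] [Field E] [Field L] [CharZero E] [Algebra k L]
    [Algebra E L] (d : Derivation k L L) (h : ∀ e : E, d (algebraMap E L e) = 0)
    (a : L) (ha : IsAlgebraic E a) : d a = 0 := by
  let d' : Derivation E L L :=
    { toFun := d
      map_add' := map_add d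
      map_smul' := by
        intro a b
        simp [Algebra.smul_def, h]
      map_one_eq_zero' := by simp
      leibniz' := by intro a b; simp }
  exact der_zero_of_alg d' a ha

lemma der_comm {k E L : Type*} [Field k] [Field E] [Field L] [CharZero E] [Algebra k L]
    [Algebra E L] [Algebra k E] [IsScalarTower k E L] [Algebra.IsAlgebraic E L]
    (d : Derivation k L L)
    (h : ∀ e : E, ∃ e' : E, d (algebraMap E L e) = algebraMap E L e')
    (σ : L ≃ₐ[E] L) (a : L) : d (σ a) = σ (d a) := by
  let τ := σ.restrictScalars k
  let d' : Derivation k L L := Derivation.mk'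
    (τ.symm.toLinearMap ∘ₗ d.toLinearMap ∘ₗ τ.toLinearMap - d.toLinearMap) (by
      intro a b
      have : ∀ x, τ.symm (τ x) = x := τ.symm_apply_apply
      simp [this]
      ring)
  have hd' : ∀ a, d' a = σ.symm (d (σ a)) - d a := fun a => rfl
  have := der_zero_tower (E := E) d' (by
    intro e
    obtain ⟨e', he⟩ := h e
    rw [hd']
    simp [he]) a (Algebra.IsAlgebraic.isAlgebraic a)
  rw [hd', sub_eq_zero] at this
  rw [← this]; simp

lemma logder_prod {k L : Type*} [Field k] [Field L] [Algebra k L] (d : Derivation k L L)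
    {ι : Type*} (s : Finset ι) (f : ι → L) (hf : ∀ i, f i ≠ 0) :
    d (∏ i ∈ s, f i) / (∏ i ∈ s, f i) = ∑ i ∈ s, d (f i) / f i := by
  classical
  induction s using Finset.induction_on with
  | empty => simp
  | insert a s ha ih =>
    rw [Finset.prod_insert ha, Finset.sum_insert ha, ← ih, Derivation.leibniz]
    have h1 := hf a
    have h2 : ∏ i ∈ s, f i ≠ 0 := Finset.prod_ne_zero_iff.mpr fun i _ => hf i
    simp only [smul_eq_mul]
    field_simp
    ring

lemma key {k F : Type*} [Field k] [Field F] [CharZero k] [Algebra k F] (t : F)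
    (ht : Transcendental k t) [Algebra.IsAlgebraic k⟮t⟯ F]
    {ι : Type*} [Fintype ι] (e : ι → k)
    (he : ∀ m : ι → ℤ, ∑ i, (m i : k) * e i = 0 → ∀ i, m i = 0)
    (z : ι → F) (hz : ∀ i, z i ≠ 0) (j : ι) (hj : z j = t) (f : F)
    (H : ∀ δ : Derivation k F F, ∑ i, algebraMap k F (e i) * (δ (z i) / z i) = δ f) : False := by
  classical
  obtain ⟨δ, hδ⟩ := exists_der t ht
  have hCF : CharZero F := charZero_of_injective_algebraMap (algebraMap k F).injective
  let E := k⟮t⟯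
  let L := AlgebraicClosure F
  have hEt : Algebra.FormallyEtale F L := Algebra.FormallyEtale.of_isSeparable _ _
  obtain ⟨Δ, hΔ⟩ := exists_ext k F L
    ((Algebra.linearMap F L).compDer δ)
  replace hΔ : ∀ s, Δ (algebraMap F L s) = algebraMap F L (δ s) := hΔ
  have hEL : Algebra.IsAlgebraic E L := Algebra.IsAlgebraic.trans E F L
  have hcl : IsAlgClosure E L := ⟨inferInstance, hEL⟩
  have hnor : Normal E L := IsAlgClosure.normal E L
  have hstab : ∀ x : E, ∃ x' : E, Δ (algebraMap E L x) = algebraMap E L x' := by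
    intro x
    refine ⟨⟨δ x, der_mem t δ hδ x x.2⟩, ?_⟩
    rw [IsScalarTower.algebraMap_apply E F L, hΔ, IsScalarTower.algebraMap_apply E F L]
    rfl
  have hcomm := der_comm (E := E) Δ hstab
  let M : IntermediateField E F := IntermediateField.adjoin E (Set.range z ∪ {f})
  have hM : FiniteDimensional E M := by
    apply IntermediateField.finiteDimensional_adjoin
    intro x _
    exact (Algebra.IsAlgebraic.isAlgebraic x).isIntegral
  have hzM : ∀ i, z i ∈ M := fun i => IntermediateField.subset_adjoin _ _ (by simp)
  have hfM : f ∈ M := IntermediateField.subset_adjoin _ _ (by simp)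
  let zM : ι → M := fun i => ⟨z i, hzM i⟩
  let fM : M := ⟨f, hfM⟩
  have hsig : ∀ σ : M →ₐ[E] L, ∑ i, algebraMap k L (e i) * (Δ (σ (zM i)) / σ (zM i)) =
      Δ (σ fM) := by
    intro σ
    let σ' : L ≃ₐ[E] L := (Algebra.IsAlgebraic.algEquivEquivAlgHom E L).symm (σ.liftNormal L)
    have hσ' : ∀ x : M, σ' (algebraMap M L x) = σ x := by
      intro x
      exact AlgHom.liftNormal_commutes σ L x
    have hσz : ∀ i, σ (zM i) = σ' (algebraMap F L (z i)) := fun i => (hσ' _).symm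
    have hσf : σ fM = σ' (algebraMap F L f) := (hσ' _).symm
    rw [hσf, hcomm, hΔ, ← H δ, map_sum, map_sum]
    refine Finset.sum_congr rfl fun i _ => ?_
    rw [hσz, hcomm, hΔ, map_mul, map_mul, map_div₀, map_div₀]
    congr 1
    rw [← IsScalarTower.algebraMap_apply k F L, IsScalarTower.algebraMap_apply k E L,
      AlgEquiv.commutes]
  let N : ι → E := fun i => Algebra.norm E (zM i)
  let T : E := Algebra.trace E M fM
  have hN : ∀ i, algebraMap F L (N i : F) = ∏ σ : M →ₐ[E] L, σ (zM i) := by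
    intro i
    rw [← Algebra.norm_eq_prod_embeddings E L (zM i)]
    rfl
  have hT : algebraMap F L (T : F) = ∑ σ : M →ₐ[E] L, σ fM := by
    rw [← trace_eq_sum_embeddings (K := E) L]
    rfl
  have hzM0 : ∀ i, zM i ≠ 0 := fun i h => hz i (congrArg Subtype.val h)
  have hN0 : ∀ i, (N i : F) ≠ 0 := by
    intro i h
    have : N i = 0 := Subtype.ext h
    exact hzM0 i (Algebra.norm_eq_zero_iff.mp this)
  have hmain : ∑ i, algebraMap k F (e i) * (δ (N i) / (N i : F)) = δ T := by
    apply (algebraMap F L).injective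
    rw [← hΔ, hT, map_sum, map_sum, ← Finset.sum_congr rfl (fun σ _ => hsig σ), Finset.sum_comm]
    refine Finset.sum_congr rfl fun i _ => ?_
    rw [← Finset.mul_sum, ← logder_prod Δ Finset.univ (fun σ : M →ₐ[E] L => σ (zM i)) , ← hN, hΔ,
      map_mul, map_div₀, ← IsScalarTower.algebraMap_apply k F L]
    intro σ
    simpa using hzM0 i
  have hNj : (N j : F) = t ^ (Module.finrank E M : ℤ) := by
    have : zM j = algebraMap E M (AdjoinSimple.gen k t) := by
      apply Subtype.ext
      simp only [zM, hj]; rfl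
    simp only [N, this, Algebra.norm_algebraMap]
    simp
  have hdec : ∀ i, ∃ (m : ℤ) (u : F), u ∈ regRing (k := k) t ∧ u⁻¹ ∈ regRing (k := k) t ∧
      (N i : F) = t ^ m * u ∧ (i = j → m = Module.finrank E M) := by
    intro i
    by_cases hij : i = j
    · subst hij
      exact ⟨Module.finrank E M, 1, one_mem _, by simp, by rw [hNj]; simp,
        fun _ => rfl⟩
    · obtain ⟨m, u, h1, h2, h3⟩ := exists_decomp ht (N i : F) (N i).2 (hN0 i)
      exact ⟨m, u, h1, h2, h3, fun h => absurd h hij⟩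
  choose m u hu hu' hmu hmj using hdec
  have hu0 : ∀ i, u i ≠ 0 := by
    intro i h
    apply hN0 i
    rw [hmu, h, mul_zero]
  have hres := residue ht δ hδ e m u hu0 hu hu' (T : F) T.2 (by
    rw [← hmain]
    refine Finset.sum_congr rfl fun i _ => ?_
    rw [hmu i])
  have h0 := he m hres j
  rw [hmj j rfl] at h0
  have : 0 < Module.finrank E M := Module.finrank_pos
  omega

lemma exists_tower {k F : Type*} [Field k] [Field F] [Algebra k F] (t : F)
    (ht : Transcendental k t) : ∃ K : IntermediateField k F, Transcendental K t ∧
      Algebra.IsAlgebraic K⟮t⟯ F := by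
  have h1 : AlgebraicIndepOn k id ({t} : Set F) := by
    exact (algebraicIndependent_singleton_iff (x := fun i : ({t} : Set F) => (i : F))
      ⟨t, rfl⟩).mpr ht
  obtain ⟨S, hS, hb⟩ := exists_isTranscendenceBasis_superset h1
  have htS : t ∈ S := hS rfl
  let s : Set S := {⟨t, htS⟩}ᶜ
  have h2 : Transcendental (Algebra.adjoin k ((Subtype.val : S → F) '' s)) t :=
    hb.1.transcendental_adjoin (i := ⟨t, htS⟩) (s := s) (by simp [s])
  refine ⟨IntermediateField.adjoin k ((Subtype.val : S → F) '' s), ?_, ?_⟩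
  · intro h
    apply h2
    exact (IsFractionRing.isAlgebraic_iff (Algebra.adjoin k ((Subtype.val : S → F) '' s))
      (IntermediateField.adjoin k ((Subtype.val : S → F) '' s)) F).mpr h
  · set K := IntermediateField.adjoin k ((Subtype.val : S → F) '' s)
    have h3 := hb.isAlgebraic_field
    have hle : IntermediateField.adjoin k (Set.range (Subtype.val : S → F)) ≤
        (K⟮t⟯).restrictScalars k := by
      rw [IntermediateField.adjoin_le_iff]
      rintro _ ⟨⟨a, ha⟩, rfl⟩
      by_cases hat : a = t
      · subst hat; exact IntermediateField.mem_adjoin_simple_self K a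
      · have : a ∈ K := IntermediateField.subset_adjoin _ _ ⟨⟨a, ha⟩, by simpa [s] using hat, rfl⟩
        exact (K⟮t⟯).algebraMap_mem ⟨a, this⟩
    let A := IntermediateField.adjoin k (Set.range (Subtype.val : S → F))
    let i : A →+* K⟮t⟯ := (IntermediateField.inclusion hle).toRingHom
    let : Algebra A K⟮t⟯ := i.toAlgebra
    have : IsScalarTower A K⟮t⟯ F := IsScalarTower.of_algebraMap_eq (fun x => rfl)
    exact Algebra.IsAlgebraic.tower_top (K := A) K⟮t⟯

lemma exists_const {k F : Type*} [Field k] [Field F] [Algebra k F] (D : Derivation k F F)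
    {ι : Type*} [Fintype ι] (R : Submodule F (ι → F))
    (hR : ∀ v ∈ R, (fun i => D (v i)) ∈ R) (v : ι → F) (hv : v ∈ R) (hv0 : v ≠ 0) :
    ∃ v ∈ R, v ≠ 0 ∧ ∀ i, D (v i) = 0 := by
  classical
  have hex : ∃ n : ℕ, ∃ v ∈ R, v ≠ 0 ∧ (Finset.univ.filter fun i => v i ≠ 0).card = n :=
    ⟨_, v, hv, hv0, rfl⟩
  obtain ⟨w, hw, hw0, hc⟩ := Nat.find_spec hex
  have hmin : ∀ u ∈ R, (Finset.univ.filter fun i => u i ≠ 0).card <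
      (Finset.univ.filter fun i => w i ≠ 0).card → u = 0 := by
    intro u hu hlt
    by_contra hu0
    rw [hc] at hlt
    exact Nat.find_min hex hlt ⟨u, hu, hu0, rfl⟩
  obtain ⟨i, hi⟩ := Function.ne_iff.mp hw0
  simp only [Pi.zero_apply] at hi
  have hwR : (w i)⁻¹ • w ∈ R := R.smul_mem _ hw
  refine ⟨(w i)⁻¹ • w, hwR, by simp [hi, hw0], ?_⟩
  have := hmin _ (hR _ hwR) (by
    apply Finset.card_lt_card
    rw [Finset.ssubset_iff_of_subset]
    · refine ⟨i, by simp [hi], ?_⟩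
      simp [hi, -Derivation.leibniz]
    · intro j
      simp only [Finset.mem_filter, Finset.mem_univ, true_and]
      intro h h2
      apply h
      rw [Pi.smul_apply, h2, smul_zero, map_zero])
  exact fun i => congrFun this i

lemma exists_int_basis {k : Type*} [Field k] [CharZero k] {n : ℕ} (c : Fin n → k) :
    ∃ (r : ℕ) (e : Fin r → k) (m : Fin n → Fin r → ℤ),
      (∀ a : Fin r → ℤ, ∑ i, (a i : k) * e i = 0 → ∀ i, a i = 0) ∧
      ∀ i, c i = ∑ j, (m i j : k) * e j := by
  let A := Submodule.span ℤ (Set.range c)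
  have hfin : Module.Finite ℤ A := Module.Finite.span_of_finite ℤ (Set.finite_range c)
  have hfree : Module.Free ℤ A := inferInstance
  let b := Module.finBasis ℤ A
  refine ⟨_, fun j => (b j : k), fun i j => b.repr ⟨c i, Submodule.subset_span ⟨i, rfl⟩⟩ j, ?_, ?_⟩
  · intro a ha
    have := Fintype.linearIndependent_iff.mp b.linearIndependent a
    apply this
    apply Subtype.ext
    simpa using ha
  · intro i
    have : ((∑ j, b.repr ⟨c i, Submodule.subset_span ⟨i, rfl⟩⟩ j • b j : A) : k) = c i :=
      congrArg Subtype.val (b.sum_repr ⟨c i, Submodule.subset_span ⟨i, rfl⟩⟩)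
    rw [Submodule.coe_sum] at this
    refine this.symm.trans (Finset.sum_congr rfl fun j _ => ?_)
    rw [Submodule.coe_smul, zsmul_eq_mul]

lemma exists_rel {F V B : Type*} [Field F] [AddCommGroup V] [Module F V] [Fintype B] {n : ℕ}
    (hB : Fintype.card B ≤ n) (r : V →ₗ[F] (B → F)) (ω : Fin n → V →ₗ[F] F)
    (hω : ∀ v, r v = 0 → ∀ i, ω i v = 0) (d : V) (hd : r d ≠ 0) (hωd : ∀ i, ω i d = 0) :
    ∃ a : Fin n → F, a ≠ 0 ∧ ∀ v, ∑ i, a i * ω i v = 0 := by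
  classical
  let W : V →ₗ[F] (Fin n → F) := LinearMap.pi ω
  have hk : LinearMap.ker r ≤ LinearMap.ker W := by
    intro v hv
    ext i
    exact hω v hv i
  -- the range of `W` has dimension `< n`
  have hker : LinearMap.ker r < LinearMap.ker W := by
    refine lt_of_le_of_ne hk fun h => hd ?_
    have : d ∈ LinearMap.ker W := by ext i; exact hωd i
    rw [← h] at this
    exact this
  let g : LinearMap.range r →ₗ[F] (Fin n → F) :=
    ((LinearMap.ker r).liftQ W hk).comp r.quotKerEquivRange.symm.toLinearMap
  have hg : ∀ v, g ⟨r v, v, rfl⟩ = W v := by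
    intro v
    simp [g]
    have : r.quotKerEquivRange.symm ⟨r v, v, rfl⟩ = Submodule.Quotient.mk v := by
      rw [LinearEquiv.symm_apply_eq]; rfl
    rw [this]; simp
  have h1 : Module.finrank F (LinearMap.range g) + Module.finrank F (LinearMap.ker g) =
      Module.finrank F (LinearMap.range r) := LinearMap.finrank_range_add_finrank_ker g
  have h2 : Module.finrank F (LinearMap.range r) ≤ n := by
    refine (Submodule.finrank_le _).trans ?_
    simpa using hB
  have h3 : 0 < Module.finrank F (LinearMap.ker g) := by
    have : Nontrivial (LinearMap.ker g) := by
      refine ⟨⟨⟨⟨r d, d, rfl⟩, ?_⟩, 0, ?_⟩⟩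
      · rw [LinearMap.mem_ker, hg]; ext i; exact hωd i
      · intro h
        exact hd (congrArg (fun x : LinearMap.ker g => ((x : LinearMap.range r) : B → F)) h)
    exact Module.finrank_pos (R := F) (M := LinearMap.ker g)
  have h4 : LinearMap.range g < ⊤ := by
    apply lt_top_iff_ne_top.mpr
    intro h
    rw [h, finrank_top] at h1
    simp at h1
    omega
  obtain ⟨f, hf0, hf⟩ := Submodule.exists_le_ker_of_lt_top _ h4
  refine ⟨fun i => f (Pi.single i 1), ?_, ?_⟩
  · intro h
    apply hf0
    apply LinearMap.pi_ext'
    intro i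
    ext
    simpa using congrFun h i
  · intro v
    have h5 : f (W v) = 0 := hf ⟨_, hg v⟩
    rw [LinearMap.pi_apply_eq_sum_univ f (W v)] at h5
    rw [← h5]
    refine Finset.sum_congr rfl fun i _ => ?_
    simp only [smul_eq_mul, W, LinearMap.pi_apply]
    rw [mul_comm]
    congr 2
    ext j
    simp [Pi.single_apply, eq_comm]

lemma logder_prod_zpow {k L : Type*} [Field k] [Field L] [Algebra k L] (d : Derivation k L L)
    {ι : Type*} (s : Finset ι) (f : ι → L) (m : ι → ℤ) (hf : ∀ i, f i ≠ 0) :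
    d (∏ i ∈ s, f i ^ m i) / (∏ i ∈ s, f i ^ m i) = ∑ i ∈ s, (m i : L) * (d (f i) / f i) := by
  rw [logder_prod d s _ (fun i => zpow_ne_zero _ (hf i))]
  refine Finset.sum_congr rfl fun i _ => ?_
  have h := hf i
  have h2 : f i ^ m i ≠ 0 := zpow_ne_zero _ h
  rw [Derivation.leibniz_zpow, zpow_sub_one₀ h]
  simp only [smul_eq_mul, zsmul_eq_mul]
  field_simp

/-- the logarithmic form `dy / y - dx` -/
def form {k F : Type*} [Field k] [Field F] [Algebra k F] (x y : F) :
    Derivation k F F →ₗ[F] F where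
  toFun δ := δ y / y - δ x
  map_add' := by intro a b; simp; ring
  map_smul' := by intro a b; simp; ring

lemma form_apply {k F : Type*} [Field k] [Field F] [Algebra k F] (x y : F) (δ : Derivation k F F) :
    form x y δ = δ y / y - δ x := rfl

theorem main {F : Type*} [Field F] [CharZero F]
    (D : Derivation ℚ F F) (C : Subfield F)
    (hC : ∀ a : F, D a = 0 ↔ a ∈ C)
    (n : ℕ) (hn : 1 ≤ n) (x y : Fin n → F)
    (hy : ∀ i, y i ≠ 0)
    (hxy : ∀ i, y i * D (x i) = D (y i))
    (hlin : ∀ q : Fin n → ℚ, (∑ i, (q i : F) * x i) ∈ C → ∀ i, q i = 0)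
    (htr : ∀ s : Set ↥(IntermediateField.adjoin ↥C (Set.range x ∪ Set.range y)),
      AlgebraicIndependent C ((↑) : s → ↥(IntermediateField.adjoin ↥C (Set.range x ∪ Set.range y)))
       → Cardinal.mk s ≤ n) : False := by
  classical
  let D' : Derivation C F F :=
    { toFun := D
      map_add' := map_add D
      map_smul' := by
        intro a b
        have : D (a : F) = 0 := (hC _).mpr a.2
        change D ((a : F) * b) = (a : F) * D b
        simp [this]
      map_one_eq_zero' := by simp
      leibniz' := by intro a b; simp }
  have hD' : ∀ a, D' a = D a := fun _ => rfl
  let ω : Fin n → Derivation C F F →ₗ[F] F := fun i => form (x i) (y i)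
  have hDx : ∀ i, D' (y i) / y i = D' (x i) := by
    intro i
    rw [hD', hD', ← hxy i]; field_simp [hy i]
  have hωD : ∀ i, ω i D' = 0 := by
    intro i
    simp only [ω, form_apply, hDx, sub_self]
  -- step 1: linear dependence over `F`
  have step1 : ∃ a : Fin n → F, a ≠ 0 ∧ ∀ δ, ∑ i, a i * ω i δ = 0 := by
    set K := IntermediateField.adjoin ↥C (Set.range x ∪ Set.range y) with hK
    obtain ⟨s, hs⟩ := exists_isTranscendenceBasis C K
    have hcard := htr s hs.1
    have hfin : Finite s := Cardinal.lt_aleph0_iff_finite.mp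
      (hcard.trans_lt (Cardinal.natCast_lt_aleph0))
    have := Fintype.ofFinite s
    have hB : Fintype.card s ≤ n := by
      rw [Cardinal.mk_fintype] at hcard
      exact_mod_cast hcard
    let r : Derivation C F F →ₗ[F] (s → F) :=
      { toFun := fun δ b => δ ((b : K) : F)
        map_add' := by intro a b; ext; simp
        map_smul' := by intro a b; ext; simp }
    have hr : ∀ δ, r δ = 0 → ∀ a ∈ K, δ a = 0 := by
      intro δ h a ha
      let d : Derivation C K F := δ.compAlgebraMap K
      have halg := hs.isAlgebraic
      have := der_zero_of_adjoin d (Set.range ((↑) : s → K)) (by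
        rintro _ ⟨b, rfl⟩
        exact congrFun h b) ⟨a, ha⟩ (Algebra.IsAlgebraic.isAlgebraic _)
      exact this
    have hxK : ∀ i, x i ∈ K := fun i => IntermediateField.subset_adjoin _ _ (Or.inl ⟨i, rfl⟩)
    have hyK : ∀ i, y i ∈ K := fun i => IntermediateField.subset_adjoin _ _ (Or.inr ⟨i, rfl⟩)
    refine exists_rel hB r ω ?_ D' ?_ hωD
    · intro δ h i
      simp only [ω, form_apply, hr δ h _ (hxK i), hr δ h _ (hyK i), zero_div, sub_zero]
    · intro h
      have h0 := hr D' h _ (hxK ⟨0, hn⟩)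
      have := hlin (Pi.single ⟨0, hn⟩ 1) (by
        rw [← hC, Finset.sum_eq_single ⟨0, hn⟩]
        · rw [hD'] at h0; simpa using h0
        · intro b _ hb; simp [hb]
        · simp) ⟨0, hn⟩
      simp at this
  -- step 2: linear dependence over `C`
  have hbr : ∀ i δ, D' (ω i δ) = ω i ⁅D', δ⁆ := by
    intro i δ
    have h1 := congrArg δ (hDx i)
    have h := hy i
    simp only [ω, form_apply, Derivation.commutator_apply, map_sub, Derivation.leibniz_div,
      ] at h1 ⊢
    have h2 := hDx i
    simp only [smul_eq_mul] at *
    field_simp at h1 ⊢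
    linear_combination h1
  obtain ⟨a, ha0, ha⟩ := step1
  let R : Submodule F (Fin n → F) :=
    { carrier := {v | ∀ δ, ∑ i, v i * ω i δ = 0}
      add_mem' := by
        intro v w hv hw δ
        simp only [Set.mem_ofPred_eq] at hv hw
        simp [add_mul, Finset.sum_add_distrib, hv δ, hw δ]
      zero_mem' := by intro δ; simp
      smul_mem' := by
        intro c v hv δ
        simp only [Set.mem_ofPred_eq] at hv
        simp [mul_assoc, ← Finset.mul_sum, hv δ] }
  obtain ⟨c, hcR, hc0, hcD⟩ := exists_const D' R (by
    intro v hv δ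
    have h1 : ∑ i, v i * ω i δ = 0 := hv δ
    have h2 : ∑ i, v i * ω i ⁅D', δ⁆ = 0 := hv ⁅D', δ⁆
    have h3 := congrArg D' h1
    rw [map_sum, map_zero] at h3
    simp only [Derivation.leibniz, smul_eq_mul, hbr, Finset.sum_add_distrib, h2, zero_add] at h3
    rw [← h3]
    exact Finset.sum_congr rfl fun i _ => mul_comm _ _) a ha ha0
  let cC : Fin n → C := fun i => ⟨c i, (hC _).mp (hcD i)⟩
  obtain ⟨r, e, m, he, hce⟩ := exists_int_basis cC
  have hce' : ∀ i, c i = ∑ j, (m i j : F) * (e j : F) := by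
    intro i
    have := congrArg (Subtype.val) (hce i)
    simpa [cC] using this
  let z : Fin r → F := fun j => ∏ i, y i ^ m i j
  have hz0 : ∀ j, z j ≠ 0 := fun j => Finset.prod_ne_zero_iff.mpr fun i _ => zpow_ne_zero _ (hy i)
  have hzlog : ∀ (δ : Derivation C F F) j, δ (z j) / z j = ∑ i, (m i j : F) * (δ (y i) / y i) :=
    fun δ j => logder_prod_zpow δ _ _ _ hy
  have hexz : ∃ j, Transcendental C (z j) := by
    by_contra hcon
    push Not at hcon
    apply hc0
    have hm : ∀ j i, m i j = 0 := by
      intro j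
      have h1 : D' (z j) = 0 := der_zero_of_alg D' (z j) (not_not.mp (hcon j))
      have h2 := hzlog D' j
      rw [h1, zero_div] at h2
      have h3 := hlin (fun i => (m i j : ℚ)) (by
        rw [← hC, map_sum, h2]
        refine Finset.sum_congr rfl fun i _ => ?_
        rw [hDx, hD']
        simp)
      intro i
      exact_mod_cast h3 i
    ext i
    rw [hce' i]
    simp [hm]
  obtain ⟨j, hj⟩ := hexz
  obtain ⟨K, hK1, hK2⟩ := exists_tower (z j) hj
  refine key (k := K) (z j) hK1 (fun i => algebraMap C K (e i)) ?_ z hz0 j rfl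
    (∑ i, c i * x i) ?_
  · intro a h
    apply he a
    apply (algebraMap C K).injective
    rw [map_zero, ← h, map_sum]
    simp
  · intro δ
    let δ' : Derivation C F F := δ.restrictScalars C
    have h1 : ∑ i, c i * ω i δ' = 0 := hcR δ'
    have h2 : δ (∑ i, c i * x i) = ∑ i, c i * δ' (x i) := by
      rw [map_sum]
      refine Finset.sum_congr rfl fun i _ => ?_
      have : δ' (c i) = 0 := δ'.map_algebraMap (cC i)
      change δ' _ = _
      simp [this]
    rw [h2]
    have h3 : ∀ i, c i * δ' (x i) = c i * (δ' (y i) / y i) - c i * ω i δ' := by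
      intro i; simp only [ω, form_apply]; ring
    simp only [h3, Finset.sum_sub_distrib, h1, sub_zero]
    change ∑ i, (e i : F) * (δ' (z i) / z i) = _
    simp only [hzlog, hce', Finset.mul_sum, Finset.sum_mul]
    rw [Finset.sum_comm]
    refine Finset.sum_congr rfl fun i _ => Finset.sum_congr rfl fun j _ => ?_
    ring

lemma le_trdeg {K L : Type*} [Field K] [Field L] [Algebra K L] (s : Set L)
    (hs : AlgebraicIndependent K ((↑) : s → L)) : Cardinal.mk s ≤ trdeg K L := by
  unfold trdeg
  exact le_ciSup (f := fun s : {s : Set L // AlgebraicIndependent K ((↑) : s → L)} =>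
    Cardinal.mk s.1) Cardinal.bddAbove_of_small ⟨s, hs⟩

lemma le_of_lt {c : Cardinal} {n : ℕ} (h : c < (n + 1 : Cardinal)) : c ≤ n := by
  have h3 : ((n + 1 : ℕ) : Cardinal) = Order.succ (n : Cardinal) := by
    rw [Cardinal.succ_natCast, Nat.cast_add, Nat.cast_one]
  rw [← Nat.cast_one, ← Nat.cast_add, h3] at h
  exact Order.lt_succ_iff.mp h

end AxS

end AxProof

/-- **Ax's theorem** (differential fields version of Schanuel's conjecture).
Let `F` be a field of characteristic zero, `D` a derivation on `F` with constant
subfield `C`.  If `x i, y i ∈ F` (with each `y i ≠ 0`) satisfy `D (x i) = D (y i) / y i`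
and the `x i` are `ℚ`-linearly independent modulo `C`, then
`td(x₁, y₁, …, xₙ, yₙ / C) ≥ n + 1`. -/
theorem ax_schanuel_differential
    {F : Type*} [Field F] [CharZero F]
    (D : Derivation ℚ F F) (C : Subfield F)
    (hC : ∀ a : F, D a = 0 ↔ a ∈ C)
    (n : ℕ) (hn : 1 ≤ n) (x y : Fin n → F)
    (hy : ∀ i, y i ≠ 0)
    (hxy : ∀ i, y i * D (x i) = D (y i))
    (hlin : ∀ q : Fin n → ℚ, (∑ i, (q i : F) * x i) ∈ C → ∀ i, q i = 0) :
    (n + 1 : Cardinal) ≤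
      trdeg ↥C ↥(IntermediateField.adjoin ↥C (Set.range x ∪ Set.range y)) := by
  by_contra hcon
  rw [not_le] at hcon
  refine AxS.main D C hC n hn x y hy hxy hlin ?_
  intro s hs
  have h1 := AxS.le_trdeg s hs
  exact AxS.le_of_lt (h1.trans_lt hcon)
end

section
/- Let A be a field, g ∈ A^N (affine N-space over some large algebraically closed field extension), Π_g the hyperplane {x : Σ p_i x_i = 1 evaluated at g}, i.e. Π_g = {p : Σ g_i p_i = 1}, and let p be a generic point of Π_g over A. Then for any tuple h algebraic over A(g), either g is algebraic over A(h), or td(h/A(p)) = td(h/A). -/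
set_option synthInstance.maxHeartbeats 1000000
set_option maxHeartbeats 1000000

open IntermediateField in
theorem gh_isAlg_adjoin {F L ι : Type*} [Field F] [Field L] [Algebra F L] (x : ι → L)
    (E : IntermediateField F L) (hE : E = adjoin F (Set.range x)) (y : ι → E)
    (hy : ∀ i, (y i : L) = x i) : Algebra.IsAlgebraic (Algebra.adjoin F (Set.range y)) E := by
  rw [← IntermediateField.isAlgebraic_adjoin_iff_top]
  have htop : adjoin F (Set.range y) = ⊤ := by
    apply IntermediateField.lift_injective
    rw [IntermediateField.lift_adjoin, IntermediateField.lift_top, ← Set.range_comp]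
    have : (Subtype.val ∘ y) = x := funext hy
    rw [this]
    exact hE.symm
  rw [htop]
  exact ⟨fun a => isAlgebraic_algebraMap (⟨a, trivial⟩ : (⊤ : IntermediateField F E))⟩

open IntermediateField in
theorem gh_trdeg_of_indep {F L : Type*} [Field F] [Field L] [Algebra F L] {N : ℕ} (x : Fin N → L)
    (hx : AlgebraicIndependent F x) : Algebra.trdeg F (adjoin F (Set.range x)) = N := by
  let y : Fin N → adjoin F (Set.range x) := fun i => ⟨x i, subset_adjoin _ _ ⟨i, rfl⟩⟩
  have hy : AlgebraicIndependent F y := by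
    apply AlgebraicIndependent.of_comp (adjoin F (Set.range x)).val
    exact hx
  have halg := gh_isAlg_adjoin x _ rfl y (fun _ => rfl)
  have hb := (hy.isTranscendenceBasis_iff_isAlgebraic).2 halg
  have := hb.lift_cardinalMk_eq_trdeg
  simpa using this.symm

theorem gh_coeff_mem {B C σ : Type*} [Field B] [Field C] [Algebra B C]
    (d : MvPolynomial σ B) (hd : d ≠ 0) (q : MvPolynomial σ C)
    (h : ∀ m, ∃ b, algebraMap B C b = (MvPolynomial.map (algebraMap B C) d * q).coeff m) (m) :
    ∃ b, algebraMap B C b = q.coeff m := by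
  classical
  obtain ⟨φ, hφ⟩ := LinearMap.exists_leftInverse_of_injective (Algebra.linearMap B C)
    (LinearMap.ker_eq_bot.2 (algebraMap B C).injective)
  have hφ' : ∀ b, φ (algebraMap B C b) = b := fun b => LinearMap.congr_fun hφ b
  let q' : MvPolynomial σ C := ∑ m ∈ q.support, MvPolynomial.monomial m (algebraMap B C (φ (q.coeff m)))
  have hq' : ∀ m, q'.coeff m = algebraMap B C (φ (q.coeff m)) := by
    intro m
    simp only [q', MvPolynomial.coeff_sum, MvPolynomial.coeff_monomial]
    rw [Finset.sum_ite_eq']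
    split_ifs with hm
    · rfl
    · rw [MvPolynomial.notMem_support_iff.1 hm]; simp
  have key : MvPolynomial.map (algebraMap B C) d * q' = MvPolynomial.map (algebraMap B C) d * q := by
    ext m
    obtain ⟨b, hb⟩ := h m
    rw [← hb, ← hφ' b, hb, MvPolynomial.coeff_mul, MvPolynomial.coeff_mul, map_sum, map_sum]
    refine Finset.sum_congr rfl fun a _ => ?_
    rw [hq', MvPolynomial.coeff_map, ← Algebra.smul_def, ← Algebra.smul_def, map_smul,
      smul_eq_mul, map_mul, Algebra.smul_def]
  have hd' : MvPolynomial.map (algebraMap B C) d ≠ 0 := by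
    intro h0
    exact hd ((MvPolynomial.map_injective _ (algebraMap B C).injective) (by rw [h0, map_zero]))
  have := mul_left_cancel₀ hd' key
  exact ⟨φ (q.coeff m), by rw [← hq', this]⟩

attribute [local instance] MvPolynomial.algebraMvPolynomial in
theorem gh_coeff_alg {F C : Type*} {σ : Type*} [Field F] [Field C] [Algebra F C]
    (q : MvPolynomial σ C) (hq : IsAlgebraic (MvPolynomial σ F) q) (m) :
    IsAlgebraic F (q.coeff m) := by
  obtain ⟨d, hd, hint⟩ := hq.exists_integral_multiple
  rw [MvPolynomial.isIntegral_iff_isIntegral_coeff] at hint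
  let B := algebraicClosure F C
  have := gh_coeff_mem (B := B) (C := C) (MvPolynomial.map (algebraMap F B) d) (by
    intro h0
    exact hd ((MvPolynomial.map_injective _ (algebraMap F B).injective) (by rw [h0, map_zero])))
    q (by
      intro m
      have h1 := (hint m).isAlgebraic
      rw [Algebra.smul_def, MvPolynomial.algebraMap_def] at h1
      rw [MvPolynomial.map_map, ← IsScalarTower.algebraMap_eq]
      exact ⟨⟨_, mem_algebraicClosure_iff.2 h1⟩, rfl⟩) m
  obtain ⟨b, hb⟩ := this
  rw [← hb]
  exact mem_algebraicClosure_iff.1 b.2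

attribute [local instance] MvPolynomial.algebraMvPolynomial in
theorem gh_coeff_alg' {F C L : Type*} {σ : Type*} [Field F] [Field C] [Field L] [Algebra F C]
    [Algebra C L] [Algebra F L] [IsScalarTower F C L] (x : σ → L) (hx : AlgebraicIndependent C x)
    (q : MvPolynomial σ C)
    (hq : IsAlgebraic (Algebra.adjoin F (Set.range x)) (MvPolynomial.aeval x q)) (m) :
    IsAlgebraic F (q.coeff m) := by
  apply gh_coeff_alg
  have hxF : AlgebraicIndependent F x := hx.restrictScalars (algebraMap F C).injective
  refine IsAlgebraic.of_ringHom_of_comp_eq (hxF.aevalEquiv : _ →+* _)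
    (MvPolynomial.aeval x : MvPolynomial σ C →ₐ[C] L).toRingHom hq hxF.aevalEquiv.surjective hx ?_
  ext i
  · rw [RingHom.comp_assoc, MvPolynomial.algebraMap_def]
    change algebraMap _ L (hxF.aevalEquiv (MvPolynomial.C i)) =
      MvPolynomial.aeval x (MvPolynomial.map (algebraMap F C) (MvPolynomial.C i))
    rw [MvPolynomial.map_C, MvPolynomial.aeval_C, hxF.algebraMap_aevalEquiv, MvPolynomial.aeval_C,
      ← IsScalarTower.algebraMap_apply]
  · rw [MvPolynomial.algebraMap_def]
    change algebraMap _ L (hxF.aevalEquiv (MvPolynomial.X i)) =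
      MvPolynomial.aeval x (MvPolynomial.map (algebraMap F C) (MvPolynomial.X i))
    rw [MvPolynomial.map_X, MvPolynomial.aeval_X, hxF.algebraMap_aevalEquiv, MvPolynomial.aeval_X]

theorem gh_coeff_zero {C σ : Type*} [Field C] [Fintype σ] (c : C) (a : σ → C) :
    (MvPolynomial.C c + ∑ j : σ, MvPolynomial.C (a j) * MvPolynomial.X j).coeff 0 = c := by
  classical
  simp [MvPolynomial.coeff_sum, MvPolynomial.coeff_C_mul]

theorem gh_coeff_one {C σ : Type*} [Field C] [Fintype σ] (c : C) (a : σ → C) (k : σ) :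
    (MvPolynomial.C c + ∑ j : σ, MvPolynomial.C (a j) * MvPolynomial.X j).coeff
      (Finsupp.single k 1) = a k := by
  classical
  have h0 : (0 : σ →₀ ℕ) ≠ Finsupp.single k 1 := fun h =>
    one_ne_zero (Finsupp.single_eq_zero.1 h.symm)
  simp only [MvPolynomial.coeff_add, MvPolynomial.coeff_sum, MvPolynomial.coeff_C_mul,
    MvPolynomial.coeff_C, MvPolynomial.coeff_X, if_neg h0, zero_add]
  rw [Finset.sum_eq_single k]
  · simp
  · intro b _ hb
    rw [if_neg, mul_zero]
    intro h
    exact hb (Finsupp.single_left_injective one_ne_zero h)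
  · simp

open IntermediateField in
theorem gh_main {L : Type*} [Field L]
    (G F : Subfield L) (N : ℕ) (g p : Fin N → L) (hg : ∀ i, g i ∈ G)
    (hF : ∀ a ∈ F, IsAlgebraic G a)
    (hmem : ∑ i, g i * p i = 1)
    (hgen : Algebra.trdeg G (adjoin G (Set.range p)) = (N - 1 : ℕ))
    (hnot : ¬ AlgebraicIndependent F p) (k : Fin N) : IsAlgebraic F (g k) := by
  classical
  obtain ⟨i, hi⟩ : ∃ i, g i ≠ 0 := by
    by_contra! h0
    simp [h0] at hmem
  let s : Set (Fin N) := {i}ᶜ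
  let x : s → L := fun j => p j
  have hsum : g i * p i + ∑ j : s, g j * p j = 1 := by
    rw [← hmem, ← Finset.add_sum_erase _ _ (Finset.mem_univ i)]
    congr 1
    symm
    apply Finset.sum_subtype
    simp [s]
  have hpi : p i = (g i)⁻¹ + ∑ j : s, (- (g i)⁻¹ * g j) * p j := by
    simp only [neg_mul, Finset.sum_neg_distrib, mul_assoc]
    rw [← Finset.mul_sum, eq_sub_of_add_eq' hsum]
    field_simp
    ring
  have hadj : adjoin G (Set.range p) = adjoin G (Set.range x) := by
    apply le_antisymm
    · rw [adjoin_le_iff]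
      have hmemx : ∀ j : s, p j ∈ adjoin G (Set.range x) := fun j => subset_adjoin _ _ ⟨j, rfl⟩
      have hmemg : ∀ j, g j ∈ adjoin G (Set.range x) := fun j =>
        (adjoin G (Set.range x)).algebraMap_mem ⟨g j, hg j⟩
      rintro _ ⟨j, rfl⟩
      by_cases hj : j = i
      · subst hj
        rw [hpi]
        exact add_mem (inv_mem (hmemg _)) (sum_mem fun l _ =>
          mul_mem (mul_mem (neg_mem (inv_mem (hmemg _))) (hmemg _)) (hmemx l))
      · exact hmemx ⟨j, hj⟩
    · apply adjoin.mono
      rintro _ ⟨j, rfl⟩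
      exact ⟨j, rfl⟩
  have hxG : AlgebraicIndependent G x := by
    let y : s → adjoin G (Set.range p) := fun j => ⟨p j, subset_adjoin _ _ ⟨j, rfl⟩⟩
    have := gh_isAlg_adjoin x _ hadj y (fun _ => rfl)
    have hb : IsTranscendenceBasis G y := by
      apply Algebra.IsAlgebraic.isTranscendenceBasis_of_lift_le_trdeg_of_finite
      rw [hgen]
      have hc : Fintype.card s = N - 1 := by
        rw [Fintype.card_compl_set]
        simp
      simp only [Cardinal.mk_fintype, hc, Cardinal.lift_natCast, le_refl]
    exact hb.1.map' (f := (adjoin G (Set.range p)).val) Subtype.val_injective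
  let C := algebraicClosure G L
  have hxC : AlgebraicIndependent C x := hxG.algebraicClosure
  letI : Algebra F C := RingHom.toAlgebra
    { toFun := fun a => ⟨a, mem_algebraicClosure_iff.2 (hF a a.2)⟩
      map_one' := rfl
      map_mul' := fun _ _ => rfl
      map_zero' := rfl
      map_add' := fun _ _ => rfl }
  haveI : IsScalarTower F C L := IsScalarTower.of_algebraMap_eq fun _ => rfl
  have hxF : AlgebraicIndependent F x := hxC.restrictScalars (algebraMap F C).injective
  have halg : IsAlgebraic (Algebra.adjoin F (Set.range x)) (p i) := by
    by_contra htr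
    apply hnot
    have h1 : AlgebraicIndepOn F p s := hxF
    have h2 := h1.insert (i := i) (by rw [Set.image_eq_range]; exact htr)
    have h3 : insert i s = Set.univ := by ext j; simp [s, em]
    rw [h3] at h2
    exact (algebraicIndependent_equiv (Equiv.Set.univ (Fin N)) (f := p)).1 h2
  let gC : Fin N → C := fun j => algebraMap G C ⟨g j, hg j⟩
  have hgC : ∀ j, algebraMap C L (gC j) = g j := fun j => rfl
  let q : MvPolynomial s C := MvPolynomial.C (gC i)⁻¹ +
    ∑ j : s, MvPolynomial.C (- (gC i)⁻¹ * gC j) * MvPolynomial.X j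
  have hq : MvPolynomial.aeval x q = p i := by
    rw [hpi]
    simp [q, x, hgC]
  have hco := gh_coeff_alg' (F := F) x hxC q (by rw [hq]; exact halg)
  have h0 : IsAlgebraic F (gC i)⁻¹ := by
    have := hco 0
    rwa [gh_coeff_zero] at this
  have h0' : IsAlgebraic F (gC i) := by simpa using h0.inv
  have hk : IsAlgebraic F (gC k) := by
    by_cases hk : k = i
    · rw [hk]; exact h0'
    · have := hco (Finsupp.single ⟨k, hk⟩ 1)
      rw [gh_coeff_one] at this
      have h5 := (h0'.neg).mul this
      have hne : gC i ≠ 0 := fun h => hi (by rw [← hgC, h, map_zero])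
      rwa [← mul_assoc, neg_mul_neg, mul_inv_cancel₀ hne, one_mul] at h5
  rw [← hgC]
  exact hk.algebraMap

/-- **Generic hyperplanes lemma.**
Work inside a large algebraically closed field `L`, over a subfield `A = K`.
Let `g ∈ 𝔸^N`, let `Πg = {p : ∑ gᵢ pᵢ = 1}` be the dual hyperplane, and let `p` be a
generic point of `Πg` over `A` (i.e. `td(p / A(g)) = N − 1`).  Then for any tuple `h`
algebraic over `A(g)`, either `g` is algebraic over `A(h)`, or
`td(h / A(p)) = td(h / A)` (i.e. `h` is independent of `p` over `A`). -/
theorem generic_hyperplanes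
    {L : Type*} [Field L] [IsAlgClosed L]
    (K : Subfield L) (N : ℕ) (g p : Fin N → L)
    (hmem : ∑ i, g i * p i = 1)
    (hgen : trdeg ↥(IntermediateField.adjoin ↥K (Set.range g))
        ↥(IntermediateField.adjoin ↥(IntermediateField.adjoin ↥K (Set.range g))
          (Set.range p)) = (N - 1 : ℕ))
    (M : ℕ) (h : Fin M → L)
    (halg : ∀ j, IsAlgebraic ↥(IntermediateField.adjoin ↥K (Set.range g)) (h j)) :
    (∀ i, IsAlgebraic ↥(IntermediateField.adjoin ↥K (Set.range h)) (g i)) ∨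
      trdeg ↥(IntermediateField.adjoin ↥K (Set.range p))
          ↥(IntermediateField.adjoin ↥(IntermediateField.adjoin ↥K (Set.range p))
            (Set.range h)) =
        trdeg ↥K ↥(IntermediateField.adjoin ↥K (Set.range h)) := by
  by_cases hind : AlgebraicIndependent (IntermediateField.adjoin ↥K (Set.range h)) p
  · right
    change Algebra.trdeg _ _ = Algebra.trdeg _ _
    have hindK : AlgebraicIndependent K p :=
      hind.restrictScalars (algebraMap K (IntermediateField.adjoin ↥K (Set.range h))).injective
    have e1 := gh_trdeg_of_indep p hind
    have e2 := gh_trdeg_of_indep p hindK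
    have t1 := trdeg_add_eq K (IntermediateField.adjoin K (Set.range p))
      (A := IntermediateField.adjoin (IntermediateField.adjoin K (Set.range p)) (Set.range h))
    have t2 := trdeg_add_eq K (IntermediateField.adjoin K (Set.range h))
      (A := IntermediateField.adjoin (IntermediateField.adjoin K (Set.range h)) (Set.range p))
    have t3 := congrArg (fun E : IntermediateField K L => Algebra.trdeg K E)
      (IntermediateField.adjoin_adjoin_comm K (Set.range p) (Set.range h))
    have t4 := t1.trans (Eq.trans t3 t2.symm)
    rw [e1, e2, add_comm] at t4
    exact Cardinal.eq_of_add_eq_add_right t4 (Cardinal.natCast_lt_aleph0)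
  · left
    intro k
    refine gh_main (IntermediateField.adjoin K (Set.range g)).toSubfield
      (IntermediateField.adjoin K (Set.range h)).toSubfield N g p
      (fun i => IntermediateField.subset_adjoin _ _ ⟨i, rfl⟩) ?_ hmem hgen hind k
    have hle : IntermediateField.adjoin K (Set.range h) ≤
        (algebraicClosure (IntermediateField.adjoin K (Set.range g)) L).restrictScalars K := by
      rw [IntermediateField.adjoin_le_iff]
      rintro _ ⟨j, rfl⟩
      exact mem_algebraicClosure_iff.2 (halg j)
    intro a ha
    exact mem_algebraicClosure_iff.1 (hle ha)
end
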